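/- arXiv:2302.08699 — 4 statements merged into one kernel-verified Lean document; each statement's English description precedes it below -/
import Mathlib

section
/- Let Σ be a nonempty finite set, k a commutative ring, and S an oriented bisection structure on Σ. Then the function η^S : Σ³ → k defined by η^S_{a,b}(c) = S(c,a) − S(c,b) − δ_{b,c} is a Σ-symbol valued in k. -/
/-- A `Σ`-symbol valued in a commutative ring `k` (alphabet `A`): a function
`η : A³ → k`, written `η a b c` for `η_{a,b}(c)`, satisfying
`η a b c * η c b d = η a b d * η a d c` and
`η a b c = η a d c + η d b c + δ_{c,d}`. -/
structure IsSigmaSymbol {A : Type} [DecidableEq A] {k : Type} [CommRing k]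
    (η : A → A → A → k) : Prop where
  rel1 : ∀ a b c d : A, η a b c * η c b d = η a b d * η a d c
  rel2 : ∀ a b c d : A, η a b c = η a d c + η d b c + (if c = d then 1 else 0)


/-- An oriented bisection structure on `A`: a function `S : A × A → {0,1}`
(encoded as an `ℕ`-valued function taking only the values `0` and `1`) with
`S a a = 0`, such that for any three distinct `x, y, z` at most one of the
equalities `S x y = S x z`, `S y x = S y z`, `S z x = S z y` fails. -/
def IsOrientedBisection {A : Type} (S : A → A → ℕ) : Prop :=
  (∀ a b, S a b = 0 ∨ S a b = 1) ∧ (∀ a, S a a = 0) ∧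
  ∀ x y z : A, x ≠ y → y ≠ z → x ≠ z →
    ((S x y = S x z ∧ S y x = S y z) ∨ (S x y = S x z ∧ S z x = S z y) ∨
      (S y x = S y z ∧ S z x = S z y))

/-- The function `η^S : A³ → k` associated to an oriented bisection structure:
`η^S a b c = S c a − S c b − δ_{b,c}`, the values of `S` being regarded as
elements of `k`. -/
def etaOf (k : Type) [CommRing k] {A : Type} [DecidableEq A]
    (S : A → A → ℕ) : A → A → A → k :=
  fun a b c => (S c a : k) - (S c b : k) - (if b = c then 1 else 0)

/-- In an oriented bisection structure, any two of the three equalities attached to a triple of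
distinct elements cannot both fail. -/
theorem IsOrientedBisection.sub_mul_sub_eq_zero {A : Type} {S : A → A → ℕ}
    (hS : IsOrientedBisection S) (k : Type) [CommRing k] {x y z : A}
    (hxy : x ≠ y) (hyz : y ≠ z) (hxz : x ≠ z) :
    ((S x y : k) - S x z) * ((S y x : k) - S y z) = 0 := by
  rcases hS.2.2 x y z hxy hyz hxz with h | h | h <;> simp [h.1, h.2]

/-- The values of an oriented bisection structure are idempotent in any commutative ring. -/
theorem IsOrientedBisection.cast_mul_self {A : Type} {S : A → A → ℕ}
    (hS : IsOrientedBisection S) (k : Type) [CommRing k] (x y : A) :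
    (S x y : k) * S x y = S x y := by
  rcases hS.1 x y with h | h <;> simp [h]

/-- For any oriented bisection structure `S` on a nonempty
finite set and any commutative ring `k`, the function `η^S` is a `Σ`-symbol
valued in `k`. -/
theorem etaOf_isSigmaSymbol {A k : Type} [Fintype A] [Nonempty A] [DecidableEq A]
    [CommRing k] (S : A → A → ℕ) (hS : IsOrientedBisection S) :
    IsSigmaSymbol (etaOf k S) := by
  have hz (x : A) : (S x x : k) = 0 := by simp [hS.2.1 x]
  have idem := hS.cast_mul_self k
  have orth {x y z : A} := hS.sub_mul_sub_eq_zero k (x := x) (y := y) (z := z)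
  refine ⟨fun a b c d => ?_, fun a b c d => ?_⟩
  · simp only [etaOf]
    by_cases hab : a = b
    · subst hab
      grind
    by_cases hcd : c = d
    · subst hcd
      grind
    by_cases hbc : b = c
    · subst hbc
      grind
    by_cases hac : a = c
    · subst hac
      grind
    by_cases hbd : b = d
    · subst hbd
      grind
    by_cases had : a = d
    · subst had
      grind
    simp only [if_neg hbc, if_neg hbd, if_neg (Ne.symm hcd), sub_zero]
    rcases hS.2.2 c d a hcd (Ne.symm had) (Ne.symm hac) with h | h | h <;>
    rcases hS.2.2 c d b hcd (Ne.symm hbd) (Ne.symm hbc) with h' | h' | h' <;>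
    grind
  · simp only [etaOf, eq_comm (a := d) (b := c)]
    ring
end

section
/- Let Σ be a nonempty finite set and let k be a connected commutative ring (a ring whose only idempotents are 0 and 1, with 0 ≠ 1). Then every Σ-symbol η valued in k is of the form η^S for a unique oriented bisection structure S on Σ, where η^S_{a,b}(c) = S(c,a) − S(c,b) − δ_{b,c}. -/
namespace IsSigmaSymbol

variable {A : Type} [DecidableEq A] {k : Type} [CommRing k] {η : A → A → A → k}

theorem apply_self (hη : IsSigmaSymbol η) (a c : A) :
    η a a c = -(if a = c then 1 else 0) := by
  have h := hη.rel2 a a c a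
  simp only [eq_comm (a := c)] at h
  linear_combination -h

theorem eq_sub_sub (hη : IsSigmaSymbol η) (a b c : A) :
    η a b c = (η a c c + 1) - (η b c c + 1) - (if b = c then 1 else 0) := by
  have h := hη.rel2 a b c c
  have h' := hη.rel2 b b c c
  rw [hη.apply_self] at h'
  simp only [if_true] at h h'
  linear_combination h - h'

theorem isIdempotentElem_add_one (hη : IsSigmaSymbol η) (a c : A) :
    (η a c c + 1) * (η a c c + 1) = η a c c + 1 := by
  have h := hη.rel1 a c c c
  rw [hη.apply_self] at h
  simp only [if_true] at h
  linear_combination -h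

theorem mul_eq_zero_of_ne (hη : IsSigmaSymbol η) {a c d : A} (hcd : c ≠ d) :
    η a c d * η a d c = 0 := by
  rw [← hη.rel1 a c c d, hη.apply_self, if_neg hcd, neg_zero, mul_zero]

end IsSigmaSymbol

theorem natCast_inj_of_zero_or_one {k : Type} [CommRing k] (h01 : (0 : k) ≠ 1) {m n : ℕ}
    (hm : m = 0 ∨ m = 1) (hn : n = 0 ∨ n = 1) (h : (m : k) = n) : m = n := by
  rcases hm with rfl | rfl <;> rcases hn with rfl | rfl <;> simp_all

theorem eq_or_eq_of_natCast_sub_mul_sub_eq_zero {k : Type} [CommRing k] (h01 : (0 : k) ≠ 1)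
    {m n p q : ℕ} (hm : m = 0 ∨ m = 1) (hn : n = 0 ∨ n = 1) (hp : p = 0 ∨ p = 1)
    (hq : q = 0 ∨ q = 1) (h : ((m : k) - n) * ((p : k) - q) = 0) : m = n ∨ p = q := by
  rcases hm with rfl | rfl <;> rcases hn with rfl | rfl <;> rcases hp with rfl | rfl <;>
    rcases hq with rfl | rfl <;> simp_all

/-- Over a connected commutative ring `k` (only idempotents `0`
and `1`, with `0 ≠ 1`), every `Σ`-symbol is of the form `η^S` for a unique
oriented bisection structure `S`. -/
theorem sigmaSymbol_eq_etaOf {A k : Type} [Fintype A] [Nonempty A] [DecidableEq A]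
    [CommRing k] (hconn : ∀ e : k, e * e = e → e = 0 ∨ e = 1)
    (h01 : (0 : k) ≠ 1) (η : A → A → A → k) (hη : IsSigmaSymbol η) :
    ∃! S : A → A → ℕ, IsOrientedBisection S ∧ η = etaOf k S := by
  have hcast : ∀ a c, ∃ n : ℕ, (n = 0 ∨ n = 1) ∧ (n : k) = η a c c + 1 := fun a c => by
    rcases hconn _ (hη.isIdempotentElem_add_one a c) with h | h
    · exact ⟨0, Or.inl rfl, by simp [h]⟩
    · exact ⟨1, Or.inr rfl, by simp [h]⟩
  choose T hT hTη using hcast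
  have heq : ∀ a b c, η a b c = (T a c : k) - T b c - (if b = c then 1 else 0) := fun a b c => by
    rw [hTη, hTη, ← hη.eq_sub_sub]
  have hpair : ∀ a c d, c ≠ d → T a d = T c d ∨ T a c = T d c := fun a c d hcd => by
    have h := hη.mul_eq_zero_of_ne (a := a) hcd
    rw [heq, heq, if_neg hcd, if_neg hcd.symm, sub_zero, sub_zero] at h
    exact eq_or_eq_of_natCast_sub_mul_sub_eq_zero h01 (hT _ _) (hT _ _) (hT _ _) (hT _ _) h
  refine ⟨fun c a => T a c, ⟨⟨fun a b => hT b a, fun a => ?_, fun x y z hxy hyz hxz => ?_⟩, ?_⟩, ?_⟩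
  · refine natCast_inj_of_zero_or_one h01 (hT a a) (Or.inl rfl) ?_
    simp [hTη, hη.apply_self]
  · have h₁ := hpair x y z hyz
    have h₂ := hpair y x z hxz
    have h₃ := hpair z x y hxy
    dsimp only
    grind
  · funext a b c
    exact heq a b c
  · rintro S ⟨⟨hS, hS0, -⟩, hSη⟩
    funext c a
    refine natCast_inj_of_zero_or_one h01 (hS c a) (hT a c) ?_
    rw [hTη, hSη]
    simp [etaOf, hS0]
end

section
/- Let Σ be a nonempty finite set, k a commutative ring, S an oriented bisection structure on Σ, and η = η^S the Σ-symbol defined by η_{a,b}(c) = S(c,a) − S(c,b) − δ_{b,c}. Then for all a, b, c, d ∈ Σ: η_{a,c}(b) · η_{a,d}(c) = η_{a,c}(b) · η_{b,d}(c). -/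
/-- For the `Σ`-symbol `η = η^S` associated to an oriented
bisection structure `S`, one has `η_{a,c}(b) · η_{a,d}(c) = η_{a,c}(b) · η_{b,d}(c)`
for all `a, b, c, d`. -/
theorem etaOf_exchange {A k : Type} [Fintype A] [Nonempty A] [DecidableEq A]
    [CommRing k] (S : A → A → ℕ) (hS : IsOrientedBisection S) :
    ∀ a b c d : A, etaOf k S a c b * etaOf k S a d c
      = etaOf k S a c b * etaOf k S b d c := by
  intro a b c d
  obtain ⟨h01, h0, h3⟩ := hS
  have key : etaOf k S a c b * ((S c a : k) - S c b) = 0 := by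
    unfold etaOf
    rcases eq_or_ne a b with rfl | hab
    · simp
    rcases eq_or_ne c b with rfl | hcb
    · rcases h01 c a with h | h <;> simp [h, h0]
    rcases eq_or_ne a c with rfl | hac
    · simp [hcb]
    have h : S b a = S b c ∨ S c a = S c b := by
      rcases h3 a b c hab hcb.symm hac with h | h | h <;> tauto
    rcases h with h | h <;> simp [h, hcb]
  have hdiff : etaOf k S a d c - etaOf k S b d c = (S c a : k) - S c b := by
    unfold etaOf
    ring
  rw [← sub_eq_zero, ← mul_sub, hdiff, key]
end

section
/- Let Σ be a nonempty finite set, k a commutative ring, S an oriented bisection structure on Σ, η = η^S the associated Σ-symbol, and ν a Σ-measure valued in k with ν_{a,b}(c) = η_{a,b}(c) for all a, b, c ∈ Σ. Then for all a, b ∈ Σ and every word w = w_1⋯w_n ∈ Σ*, setting w_0 = a and w_{n+1} = b, one has ν_{a,b}(w) = ∏_{i=1}^{n} η_{w_{i-1}, w_{i+1}}(w_i). -/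
/-- A `Σ`-measure valued in a commutative ring `k` (alphabet `A`): a rule `ν`
assigning to `a b : A` and a word `w : List A` an element `ν a b w : k`, such
that (a) `ν a b [] = 1`; (b) `ν a b (w ++ c :: w') = ν a b (w ++ w') * ν wr w'1 c`
where `wr` is the last letter of `w` (or `a` if `w` is empty) and `w'1` is the
first letter of `w'` (or `b` if `w'` is empty); (c) the splitting relation with
respect to any letter `c` (here `w.take i = w[1,i]`, `w.drop i = w(i,n]`, and the
second sum runs over the positions of `w` carrying the letter `c`). -/
structure IsSigmaMeasure {A : Type} [DecidableEq A] {k : Type} [CommRing k]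
    (ν : A → A → List A → k) : Prop where
  nil : ∀ a b : A, ν a b [] = 1
  ins : ∀ (a b c : A) (w w' : List A),
    ν a b (w ++ c :: w') = ν a b (w ++ w') * ν (w.getLastD a) (w'.headD b) [c]
  split : ∀ (a b c : A) (w : List A),
    ν a b w = (∑ i ∈ Finset.range (w.length + 1), ν a c (w.take i) * ν c b (w.drop i))
      + ∑ j ∈ Finset.range w.length,
          if w.getD j c = c then ν a c (w.take j) * ν c b (w.drop (j + 1)) else 0


/-- If `η (c, b; d)` is nonzero, then `η (a, b; c)` and `η (a, d; c)` agree. -/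
theorem etaOf_mul_etaOf (k : Type) [CommRing k] {A : Type} [DecidableEq A]
    {S : A → A → ℕ} (hS : IsOrientedBisection S) (a b c d : A) :
    etaOf k S a b c * etaOf k S c b d = etaOf k S a d c * etaOf k S c b d := by
  obtain ⟨h01, h0, h3⟩ := hS
  by_cases hdb : d = b
  · rw [hdb]
  by_cases h : S d c = S d b
  · simp [etaOf, h, Ne.symm hdb]
  have hcb : b ≠ c := by
    rintro rfl
    exact h rfl
  have hac : etaOf k S a b c = etaOf k S a d c := by
    by_cases hcd : d = c
    · subst hcd
      have hb : S d b = 1 := (h01 d b).resolve_left fun h' => h ((h0 d).trans h'.symm)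
      simp [etaOf, hb, h0, hcb]
    · have hS' : S c d = S c b := by
        rcases h3 c d b (Ne.symm hcd) hdb hcb.symm with h' | h' | h'
        · exact h'.1
        · exact h'.1
        · exact absurd h'.1 h
      simp [etaOf, hS', hcb, hcd]
  rw [hac]

/-- Removing the last letter `c` of a word moves the right endpoint to `c`. -/
theorem IsSigmaMeasure.append_singleton {A k : Type} [DecidableEq A] [CommRing k]
    {S : A → A → ℕ} (hS : IsOrientedBisection S)
    {ν : A → A → List A → k} (hν : IsSigmaMeasure ν)
    (h1 : ∀ a b c : A, ν a b [c] = etaOf k S a b c) (a : A) (w : List A) :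
    ∀ b c : A, ν a b (w ++ [c]) = ν a c w * etaOf k S (w.getLastD a) b c := by
  have key : ∀ b c : A, ν a b (w ++ [c]) = ν a b w * etaOf k S (w.getLastD a) b c := by
    intro b c
    simpa [h1] using hν.ins a b c w []
  induction w using List.reverseRecOn with
  | nil => simp [h1, hν.nil]
  | append_singleton w d ih =>
    have ih' := ih fun b c => by simpa [h1] using hν.ins a b c w []
    intro b c
    have h := etaOf_mul_etaOf k hS (w.getLastD a) b d c
    rw [key, ih' b d, ih' c d, List.getLastD_concat, mul_assoc, mul_assoc, h]

/-- Let `S` be an oriented bisection structure, `η = η^S` the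
associated `Σ`-symbol, and `ν` a `Σ`-measure whose restriction to length-one
words is `η`.  Then for `a, b` and a word `w = w₁⋯wₙ`, setting `w₀ = a` and
`w_{n+1} = b` (so that the extended word is `a :: (w ++ [b])`),
`ν a b w = ∏_{i=1}^{n} η (w_{i-1}) (w_{i+1}) (w_i)`. -/
theorem sigmaMeasure_eq_prod {A k : Type} [Fintype A] [Nonempty A] [DecidableEq A]
    [CommRing k] (S : A → A → ℕ) (hS : IsOrientedBisection S)
    (ν : A → A → List A → k) (hν : IsSigmaMeasure ν)
    (h1 : ∀ a b c : A, ν a b [c] = etaOf k S a b c) :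
    ∀ (a b : A) (w : List A),
      ν a b w = ∏ i ∈ Finset.range w.length,
        etaOf k S ((a :: (w ++ [b])).getD i a) ((a :: (w ++ [b])).getD (i + 2) a)
          ((a :: (w ++ [b])).getD (i + 1) a) := by
  intro a b w
  induction w using List.reverseRecOn generalizing b with
  | nil => simp [hν.nil]
  | append_singleton w c ih =>
    rw [hν.append_singleton hS h1, ih c, List.length_append, List.length_singleton,
      Finset.prod_range_succ]
    have hget : ∀ j, j < w.length + 2 →
        (a :: (w ++ [c] ++ [b])).getD j a = (a :: (w ++ [c])).getD j a := by
      intro j hj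
      rw [← List.cons_append, List.getD_append _ _ _ _ (by simp; omega)]
    have hlast : (a :: (w ++ [c])).getD w.length a = w.getLastD a := by
      induction w using List.reverseRecOn with
      | nil => rfl
      | append_singleton w d _ => simp [List.getD_eq_getElem?_getD]
    congr 1
    · refine Finset.prod_congr rfl fun i hi => ?_
      have hi := Finset.mem_range.mp hi
      rw [hget i (by omega), hget (i + 1) (by omega), hget (i + 2) (by omega)]
    · rw [hget _ (by omega), hget (w.length + 1) (by omega), hlast]
      simp [List.getD_eq_getElem?_getD]
end
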